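/- arXiv:2501.13659 — 2 statements merged into one kernel-verified Lean document; each statement's English description precedes it below -/
import Mathlib

section
/- Let b be a prime, let m ≥ 1 and s ≥ 1 be integers, and let C_1, …, C_s be m×m matrices over 𝔽_b. Let u ⊆ {1,…,s} be nonempty with maximal element ū := max(u), and let t_u be an integer with 0 ≤ t_u ≤ m such that ρ_m((C_j)_{j∈u}) ≥ m − t_u. Let 0 = w_1 ≤ w_2 ≤ ⋯ ≤ w_s be nonnegative integers and let C̃_1, …, C̃_s be the corresponding row reduced matrices. Then ρ_m((C̃_j)_{j∈u}) ≥ max{0, m − max{w_ū, t_u}}. -/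
open scoped BigOperators

/-- Linear independence of the system consisting of the first `d j` rows of each matrix `C j`. -/
def rowsLinIndep (b m : ℕ) {ι : Type*} (C : ι → Matrix (Fin m) (Fin m) (ZMod b))
    (d : ι → ℕ) : Prop :=
  LinearIndependent (ZMod b)
    (fun p : {p : ι × Fin m // (p.2 : ℕ) < d p.1} => C p.1.1 p.1.2)

/-- The linear independence parameter `ρ_m(C_1,…,C_s)`: the largest `d ∈ {0,…,m}` such that
for every choice of nonnegative integers `d_j` summing to `d`, the collection of the first `d_j`
rows of the matrices is linearly independent. -/
noncomputable def rho (b m : ℕ) {ι : Type*} [Fintype ι]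
    (C : ι → Matrix (Fin m) (Fin m) (ZMod b)) : ℕ :=
  sSup {d | d ≤ m ∧ ∀ dv : ι → ℕ, (∑ j, dv j) = d → rowsLinIndep b m C dv}

/-- Row reduced matrix: the last `min m w` rows are set to zero. -/
def rowReduced {b m : ℕ} (C : Matrix (Fin m) (Fin m) (ZMod b)) (w : ℕ) :
    Matrix (Fin m) (Fin m) (ZMod b) :=
  Matrix.of fun i r => if (i : ℕ) < m - min m w then C i r else 0

/-- Column-row reduced matrix: the last `min m w` rows and columns are set to zero. -/
def colRowReduced {b m : ℕ} (C : Matrix (Fin m) (Fin m) (ZMod b)) (w : ℕ) :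
    Matrix (Fin m) (Fin m) (ZMod b) :=
  Matrix.of fun i r => if (i : ℕ) < m - min m w ∧ (r : ℕ) < m - min m w then C i r else 0

/-- Reduced matrix with possibly different row/column reduction indices. -/
def colRowReduced' {b m : ℕ} (C : Matrix (Fin m) (Fin m) (ZMod b)) (wr wc : ℕ) :
    Matrix (Fin m) (Fin m) (ZMod b) :=
  Matrix.of fun i r => if (i : ℕ) < m - min m wr ∧ (r : ℕ) < m - min m wc then C i r else 0

/-- Upper-left `m × m` submatrix of an infinite matrix. -/
def upperLeft {b : ℕ} (C : Matrix ℕ ℕ (ZMod b)) (m : ℕ) : Matrix (Fin m) (Fin m) (ZMod b) :=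
  Matrix.of fun i r => C (i : ℕ) (r : ℕ)

/-- The `k`-th coordinate value produced by the digital method with generating matrix `C`. -/
noncomputable def digitalPoint (b m : ℕ) (C : Matrix (Fin m) (Fin m) (ZMod b)) (k : ℕ) : ℝ :=
  ∑ i : Fin m,
    ((C.mulVec fun r : Fin m => ((k / b ^ (r : ℕ)) % b : ZMod b)) i).val
      / (b : ℝ) ^ ((i : ℕ) + 1)

open Classical in
/-- The `b^m` points `P 0, …, P (b^m - 1)` form a `(t,m,|ι|)`-net in base `b` (counted with
multiplicity): every elementary interval of volume `b^(t-m)` contains exactly `b^t` points. -/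
def isNet (b m t : ℕ) {ι : Type*} [Fintype ι] (P : ℕ → ι → ℝ) : Prop :=
  ∀ d a : ι → ℕ, (∀ j, a j < b ^ d j) → (∑ j, d j) = m - t →
    ((Finset.range (b ^ m)).filter fun k =>
        ∀ j, (a j : ℝ) / (b : ℝ) ^ d j ≤ P k j ∧ P k j < ((a j : ℝ) + 1) / (b : ℝ) ^ d j).card
      = b ^ t

/-- lower bound for the projection onto coordinates in `u`:
`ρ_m((C̃_j)_{j∈u}) ≥ max{0, m − max{w_ū, t_u}}`. -/
theorem rho_rowReduced_proj_ge (b m s : ℕ) (hb : Nat.Prime b) (hm : 1 ≤ m) (hs : 1 ≤ s)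
    (C : Fin s → Matrix (Fin m) (Fin m) (ZMod b))
    (u : Finset (Fin s)) (hu : u.Nonempty) (tu : ℕ) (htu : tu ≤ m)
    (hrho : m - tu ≤ rho b m (fun j : ↥u => C j))
    (w : Fin s → ℕ) (hw1 : w ⟨0, hs⟩ = 0) (hwmono : Monotone w) :
    max 0 (m - max (w (u.max' hu)) tu) ≤
      rho b m (fun j : ↥u => rowReduced (C j) (w j)) := by
  classical
  have h0 : (0 : ℕ) ∈ {d | d ≤ m ∧ ∀ dv : ↥u → ℕ, (∑ j, dv j) = d →
      rowsLinIndep b m (fun j : ↥u => C j) dv} := by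
    refine ⟨Nat.zero_le _, fun dv hdv => ?_⟩
    have hz : ∀ j, dv j = 0 := by
      intro j
      have := Finset.single_le_sum (f := dv) (fun i _ => Nat.zero_le _) (Finset.mem_univ j)
      omega
    unfold rowsLinIndep
    haveI : IsEmpty {p : ↥u × Fin m // (p.2 : ℕ) < dv p.1} :=
      ⟨fun p => by have := p.2; rw [hz] at this; omega⟩
    exact linearIndependent_empty_type
  have hmem := Nat.sSup_mem ⟨0, h0⟩ ⟨m, fun d hd => hd.1⟩
  change rho b m (fun j : ↥u => C j) ∈ _ at hmem
  obtain ⟨hR, hind⟩ := hmem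
  rw [Nat.zero_max]
  refine le_csSup ⟨m, fun d hd => hd.1⟩ ⟨Nat.sub_le _ _, fun dv hdv => ?_⟩
  set R := rho b m (fun j : ↥u => C j)
  let j0 : ↥u := ⟨u.max' hu, u.max'_mem hu⟩
  have hle : (∑ j, dv j) ≤ R := by omega
  have hbig := hind (fun j => dv j + if j = j0 then R - ∑ j, dv j else 0) (by
    rw [Finset.sum_add_distrib, Finset.sum_ite_eq' Finset.univ j0]
    simp only [Finset.mem_univ, if_true]
    omega)
  unfold rowsLinIndep at hbig ⊢
  let f : {p : ↥u × Fin m // (p.2 : ℕ) < dv p.1} →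
      {p : ↥u × Fin m // (p.2 : ℕ) < dv p.1 + if p.1 = j0 then R - ∑ j, dv j else 0} :=
    fun p => ⟨p.1, lt_of_lt_of_le p.2 (Nat.le_add_right _ _)⟩
  have hf : Function.Injective f := by
    intro p q h
    have h1 := congrArg Subtype.val h
    exact Subtype.ext h1
  have hres := hbig.comp f hf
  convert hres using 1
  funext p
  have hp := p.2
  have h1 := Finset.single_le_sum (f := dv) (fun i _ => Nat.zero_le _) (Finset.mem_univ p.1.1)
  have h2 : w p.1.1 ≤ w (u.max' hu) := hwmono (u.le_max' _ p.1.1.2)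
  have h3 : (p.1.2 : ℕ) < m - min m (w p.1.1) := by omega
  funext r
  simp [rowReduced, f, h3]
end

section
/- Let b be a prime, let m ≥ 1, s ≥ 1 and t be integers with 0 ≤ t ≤ m, and let C_1, …, C_s be infinite matrices over 𝔽_b generating a digital (t,s)-sequence, in the sense that for every integer m' with max(t,1) ≤ m' ≤ m, the upper-left m'×m' submatrices satisfy ρ_{m'}(C_1^{(m')},…,C_s^{(m')}) ≥ m' − t. Let 0 = w_1 ≤ w_2 ≤ ⋯ ≤ w_s be nonnegative integers, let C̃_1, …, C̃_s be the column-row reduced m×m matrices obtained from C_1^{(m)},…,C_s^{(m)}, and set t̃ := min{m, w_s + t}. Then the b^m points generated by C̃_1, …, C̃_s via the digital method form a (t̃, m, s)-net in base b; that is, every elementary interval ∏_{j=1}^s [a_j b^{−d_j}, (a_j+1) b^{−d_j}) with nonnegative integers d_j, 0 ≤ a_j < b^{d_j} and d_1+⋯+d_s = m − t̃ contains exactly b^{t̃} of the points (counted with multiplicity). -/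
open scoped BigOperators

/-- digit characterisation of elementary intervals -/
lemma elem_iff (b m : ℕ) [NeZero b] (d a : ℕ) (hd : d ≤ m) (ha : a < b ^ d)
    (y : Fin m → ZMod b) :
    ((a : ℝ) / (b : ℝ) ^ d ≤ ∑ i : Fin m, ((y i).val : ℝ) / (b : ℝ) ^ ((i : ℕ) + 1) ∧
      ∑ i : Fin m, ((y i).val : ℝ) / (b : ℝ) ^ ((i : ℕ) + 1) < ((a : ℝ) + 1) / (b : ℝ) ^ d) ↔
    ∀ i : Fin m, (i : ℕ) < d → y i = ((a / b ^ (d - 1 - (i : ℕ)) % b : ℕ) : ZMod b) := by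
  have hb0 : 0 < b := Nat.pos_of_ne_zero (NeZero.ne b)
  have hbR : (0 : ℝ) < b := by exact_mod_cast hb0
  let f : Fin m → Fin b := fun i => ⟨(y i.rev).val, ZMod.val_lt _⟩
  let S : ℕ := finFunctionFinEquiv f
  have hS : S = ∑ i : Fin m, (y i.rev).val * b ^ (i : ℕ) := by
    simp [S, f]
  have hSlt : S < b ^ m := (finFunctionFinEquiv f).2
  have hdig : ∀ i : Fin m, S / b ^ (m - 1 - (i : ℕ)) % b = (y i).val := by
    intro i
    have h := congrFun (finFunctionFinEquiv.symm_apply_apply f) i.rev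
    have h2 := congrArg Fin.val h
    rw [finFunctionFinEquiv_symm_apply_val] at h2
    simp only [f, Fin.rev_rev, Fin.val_rev] at h2
    rw [← h2]
    congr 3
    omega
  have hx : ∑ i : Fin m, ((y i).val : ℝ) / (b : ℝ) ^ ((i : ℕ) + 1) = (S : ℝ) / (b : ℝ) ^ m := by
    rw [hS, ← Equiv.sum_comp Fin.revPerm]
    push_cast
    rw [Finset.sum_div]
    refine Finset.sum_congr rfl fun i _ => ?_
    have : (b : ℝ) ^ m = b ^ ((Fin.rev i : ℕ) + 1) * b ^ (i : ℕ) := by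
      rw [← pow_add]; congr 1; rw [Fin.val_rev]; omega
    rw [this, Fin.revPerm_apply]
    field_simp
  have hm : (b : ℝ) ^ m = b ^ (m - d) * b ^ d := by rw [← pow_add]; congr 1; omega
  have key : ((a : ℝ) / (b : ℝ) ^ d ≤ (S : ℝ) / (b : ℝ) ^ m ∧
      (S : ℝ) / (b : ℝ) ^ m < ((a : ℝ) + 1) / (b : ℝ) ^ d) ↔ S / b ^ (m - d) = a := by
    rw [hm, ← div_div, div_le_div_iff_of_pos_right (by positivity),
      div_lt_div_iff_of_pos_right (by positivity), le_div_iff₀ (by positivity),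
      div_lt_iff₀ (by positivity), Nat.div_eq_iff (by positivity)]
    have hp : 0 < b ^ (m - d) := by positivity
    constructor
    · rintro ⟨h1, h2⟩
      have h1' : a * b ^ (m - d) ≤ S := by exact_mod_cast h1
      have h2' : S < (a + 1) * b ^ (m - d) := by exact_mod_cast h2
      constructor
      · omega
      · rw [add_mul] at h2'; omega
    · rintro ⟨h1, h2⟩
      have h2' : S < (a + 1) * b ^ (m - d) := by rw [add_mul]; omega
      exact ⟨by exact_mod_cast h1, by exact_mod_cast h2'⟩
  rw [hx, key]
  have hdd : ∀ i : ℕ, i < d → S / b ^ (m - d) / b ^ (d - 1 - i) = S / b ^ (m - 1 - i) := by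
    intro i hi
    rw [Nat.div_div_eq_div_mul, ← pow_add]; congr 2; omega
  constructor
  · rintro h i hi
    rw [← h, hdd i hi, hdig, ZMod.natCast_zmod_val]
  · intro h
    have hq : S / b ^ (m - d) < b ^ d := by
      rw [Nat.div_lt_iff_lt_mul (by positivity), ← pow_add]
      convert hSlt using 2; omega
    have : (⟨S / b ^ (m - d), hq⟩ : Fin (b ^ d)) = ⟨a, ha⟩ := by
      apply finFunctionFinEquiv.symm.injective
      funext e
      apply Fin.ext
      rw [finFunctionFinEquiv_symm_apply_val, finFunctionFinEquiv_symm_apply_val]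
      have he := e.2
      have h3 := hdd (d - 1 - e) (by omega)
      have h4 := hdig ⟨d - 1 - e, by omega⟩
      have h5 := congrArg ZMod.val (h ⟨d - 1 - e, by omega⟩ (by simp; omega))
      rw [ZMod.val_natCast, Nat.mod_mod] at h5
      have h6 : d - 1 - (d - 1 - (e : ℕ)) = e := by omega
      simp only [h6] at h3 h4 h5 ⊢
      rw [h3, h4, h5]
    exact congrArg Fin.val this

lemma card_fiber (b m : ℕ) [Fact b.Prime] {I : Type*} [Fintype I]
    (A : Matrix I (Fin m) (ZMod b)) (hA : LinearIndependent (ZMod b) A.row) (z : I → ZMod b)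
    (t : ℕ) (ht : Fintype.card I + t = m) [DecidablePred fun v : Fin m → ZMod b => A.mulVec v = z] :
    (Finset.univ.filter fun v : Fin m → ZMod b => A.mulVec v = z).card = b ^ t := by
  classical
  have hb0 : 0 < b := (Fact.out : b.Prime).pos
  have hsurj : Function.Surjective A.mulVecLin := by
    rw [← LinearMap.range_eq_top]
    apply Submodule.eq_top_of_finrank_eq
    have := hA.rank_matrix
    rw [Matrix.rank] at this
    rw [this, Module.finrank_fintype_fun_eq_card]
  have hfib : ∀ z', (Finset.univ.filter fun v : Fin m → ZMod b => A.mulVec v = z').card =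
      (Finset.univ.filter fun v : Fin m → ZMod b => A.mulVec v = z).card := by
    intro z'
    have := AddMonoidHom.card_fiber_eq_of_mem_range A.mulVecLin.toAddMonoidHom
      (hsurj z') (hsurj z)
    convert this <;> rfl
  have h1 := Finset.card_eq_sum_card_fiberwise (s := (Finset.univ : Finset (Fin m → ZMod b)))
    (t := (Finset.univ : Finset (I → ZMod b))) (f := A.mulVec) (by intro x _; simp)
  simp only [hfib] at h1
  simp only [Finset.sum_const, Finset.card_univ, Fintype.card_fun, ZMod.card, Fintype.card_fin,
    smul_eq_mul] at h1
  have hp : b ^ m = b ^ Fintype.card I * b ^ t := by rw [← pow_add, ht]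
  exact Nat.eq_of_mul_eq_mul_left (by positivity) (h1.symm.trans hp)

lemma net_count (b m : ℕ) (hb : b.Prime) {ι : Type*} [Fintype ι] (D : ι → Matrix (Fin m) (Fin m) (ZMod b))
    (t : ℕ) (ht : t ≤ m)
    (h : ∀ d : ι → ℕ, ∑ j, d j = m - t → rowsLinIndep b m D d) :
    isNet b m t (fun k j => digitalPoint b m (D j) k) := by
  classical
  have : Fact b.Prime := ⟨hb⟩
  have : NeZero b := ⟨hb.ne_zero⟩
  intro d a ha hd
  have hdm : ∀ j, d j ≤ m := fun j => by
    have := Finset.single_le_sum (f := d) (fun i _ => Nat.zero_le _) (Finset.mem_univ j)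
    omega
  have hli := h d hd
  let A : Matrix {p : ι × Fin m // (p.2 : ℕ) < d p.1} (Fin m) (ZMod b) :=
    Matrix.of fun p => D p.1.1 p.1.2
  let z : {p : ι × Fin m // (p.2 : ℕ) < d p.1} → ZMod b := fun p =>
    ((a p.1.1 / b ^ (d p.1.1 - 1 - (p.1.2 : ℕ)) % b : ℕ) : ZMod b)
  have hcard : Fintype.card {p : ι × Fin m // (p.2 : ℕ) < d p.1} = m - t := by
    let e : {p : ι × Fin m // (p.2 : ℕ) < d p.1} ≃ (Σ j : ι, Fin (d j)) :=
      { toFun := fun p => ⟨p.1.1, ⟨p.1.2, p.2⟩⟩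
        invFun := fun q => ⟨(q.1, ⟨q.2, q.2.2.trans_le (hdm q.1)⟩), q.2.2⟩
        left_inv := fun p => rfl
        right_inv := fun q => rfl }
    rw [Fintype.card_congr e, Fintype.card_sigma]
    simpa using hd
  have hA : LinearIndependent (ZMod b) A.row := hli
  rw [← card_fiber b m A hA z t (by omega)]
  refine Finset.card_bij
    (fun k _ => fun r : Fin m => ((k / b ^ (r : ℕ) % b : ℕ) : ZMod b)) ?_ ?_ ?_
  · intro k hk
    rw [Finset.mem_filter] at hk ⊢
    refine ⟨Finset.mem_univ _, ?_⟩
    funext p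
    exact (elem_iff b m (d p.1.1) (a p.1.1) (hdm _) (ha _) _).1 (hk.2 p.1.1) p.1.2 p.2
  · intro k hk k' hk' hkk
    rw [Finset.mem_filter, Finset.mem_range] at hk hk'
    have : (⟨k, hk.1⟩ : Fin (b ^ m)) = ⟨k', hk'.1⟩ := by
      apply finFunctionFinEquiv.symm.injective
      funext e
      apply Fin.ext
      rw [finFunctionFinEquiv_symm_apply_val, finFunctionFinEquiv_symm_apply_val]
      have := congrArg ZMod.val (congrFun hkk e)
      simpa only [ZMod.val_natCast, Nat.mod_mod] using this
    exact congrArg Fin.val this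
  · intro v hv
    rw [Finset.mem_filter] at hv
    let f : Fin m → Fin b := fun i => ⟨(v i).val, ZMod.val_lt _⟩
    have hk : (fun r : Fin m =>
        (((finFunctionFinEquiv f : Fin (b ^ m)) : ℕ) / b ^ (r : ℕ) % b : ℕ)) =
        fun r => (v r).val := by
      funext r
      have h := congrFun (finFunctionFinEquiv.symm_apply_apply f) r
      have h2 := congrArg Fin.val h
      rwa [finFunctionFinEquiv_symm_apply_val] at h2
    have hk2 : (fun r : Fin m =>
        ((((finFunctionFinEquiv f : Fin (b ^ m)) : ℕ) / b ^ (r : ℕ) % b : ℕ) : ZMod b)) = v := by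
      funext r
      rw [congrFun hk r, ZMod.natCast_zmod_val]
    refine ⟨(finFunctionFinEquiv f : Fin (b ^ m)), ?_, hk2⟩
    rw [Finset.mem_filter, Finset.mem_range]
    refine ⟨(finFunctionFinEquiv f).2, fun j => ?_⟩
    refine (elem_iff b m (d j) (a j) (hdm _) (ha _) _).2 fun i hi => ?_
    rw [hk2]
    exact congrFun hv.2 ⟨(j, i), hi⟩

lemma rowsLinIndep_of_rho (b m n : ℕ) {s : ℕ} (hs : 1 ≤ s) (hn : 0 < n)
    (C : Fin s → Matrix (Fin m) (Fin m) (ZMod b)) (h : n ≤ rho b m C)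
    (d : Fin s → ℕ) (hd : ∑ j, d j = n) : rowsLinIndep b m C d := by
  have hne : {d | d ≤ m ∧ ∀ dv : Fin s → ℕ, (∑ j, dv j) = d → rowsLinIndep b m C dv}.Nonempty := by
    by_contra hc
    rw [Set.not_nonempty_iff_eq_empty] at hc
    rw [rho, hc] at h
    simp at h
    omega
  have hmem := Nat.sSup_mem hne ⟨m, fun x hx => hx.1⟩
  change rho b m C ∈ _ at hmem
  have h2 := hmem.2 (fun j => d j + if j = ⟨0, hs⟩ then rho b m C - n else 0) (by
    rw [Finset.sum_add_distrib, hd]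
    simp
    omega)
  unfold rowsLinIndep at h2 ⊢
  exact h2.comp (fun p : {p : Fin s × Fin m // (p.2 : ℕ) < d p.1} =>
      ⟨p.1, p.2.trans_le (Nat.le_add_right _ _)⟩)
    (fun p q hpq => Subtype.ext (congrArg (fun x => x.1) hpq))

/-- points generated by the column-row reduced matrices derived from a digital
`(t,s)`-sequence form a `(t̃,m,s)`-net with `t̃ = min{m, w_s + t}`. -/
theorem colRowReduced_isNet (b m s t : ℕ) (hb : Nat.Prime b) (hm : 1 ≤ m) (hs : 1 ≤ s)
    (ht : t ≤ m) (C : Fin s → Matrix ℕ ℕ (ZMod b))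
    (hseq : ∀ m', max t 1 ≤ m' → m' ≤ m →
      m' - t ≤ rho b m' (fun j => upperLeft (C j) m'))
    (w : Fin s → ℕ) (hw1 : w ⟨0, hs⟩ = 0) (hwmono : Monotone w) :
    isNet b m (min m (w ⟨s - 1, by omega⟩ + t))
      (fun k (j : Fin s) =>
        digitalPoint b m (colRowReduced (upperLeft (C j) m) (w j)) k) := by
  refine net_count b m hb _ _ (min_le_left _ _) ?_
  intro d hd
  set W := w ⟨s - 1, by omega⟩ with hW
  have hwW : ∀ j, w j ≤ W := fun j => hwmono (by
    rw [Fin.le_def]; have := j.2; simp; omega)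
  have hdle : ∀ j, d j ≤ m - min m (W + t) := fun j => by
    have := Finset.single_le_sum (f := d) (fun i _ => Nat.zero_le _) (Finset.mem_univ j)
    omega
  by_cases hc : m ≤ W + t
  · unfold rowsLinIndep
    have : IsEmpty {p : Fin s × Fin m // (p.2 : ℕ) < d p.1} := ⟨fun p => by
      have := hdle p.1.1
      have := p.2
      omega⟩
    exact linearIndependent_empty_type
  · have h1 := rowsLinIndep_of_rho b (m - W) (m - W - t) hs (by omega) _
      (hseq (m - W) (by omega) (by omega)) d (by omega)
    unfold rowsLinIndep at h1 ⊢
    have h2 := h1.comp (fun p : {p : Fin s × Fin m // (p.2 : ℕ) < d p.1} =>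
      (⟨(p.1.1, ⟨p.1.2, by have := hdle p.1.1; have := p.2; omega⟩), p.2⟩ :
        {p : Fin s × Fin (m - W) // (p.2 : ℕ) < d p.1})) (by
      rintro ⟨⟨j, i⟩, hp⟩ ⟨⟨j', i'⟩, hp'⟩ hpq
      simp only [Subtype.mk.injEq, Prod.mk.injEq, Fin.mk.injEq] at hpq
      obtain ⟨h1, h2⟩ := hpq
      subst h1
      have := Fin.ext h2
      subst this
      rfl)
    refine LinearIndependent.of_comp
      (LinearMap.funLeft (ZMod b) (ZMod b) (Fin.castLE (show m - W ≤ m by omega))) ?_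
    convert h2 using 1
    funext p
    funext r
    have h3 := hdle p.1.1
    have h4 := p.2
    have h5 := hwW p.1.1
    have h6 := r.2
    simp only [Function.comp, LinearMap.funLeft_apply, colRowReduced, upperLeft, Matrix.of_apply,
      Fin.val_castLE]
    rw [if_pos]
    constructor <;> omega
end
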